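/- Assume Hypothesis 3.1. For every h ∈ D(A*) the functions x ↦ cos⟨x,h⟩ and x ↦ sin⟨x,h⟩ belong to D(U), and U(cos⟨·,h⟩)(x) = −(1/2)⟨Ch,h⟩ cos⟨x,h⟩ − ⟨x, A*h⟩ sin⟨x,h⟩ and U(sin⟨·,h⟩)(x) = −(1/2)⟨Ch,h⟩ sin⟨x,h⟩ + ⟨x, A*h⟩ cos⟨x,h⟩; i.e., for φ_h(x) = e^{i⟨x,h⟩} one has Uφ_h = (1/2)Tr[C D²φ_h] + ⟨x, A* Dφ_h⟩. -/

import Mathlib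

open MeasureTheory Set Filter Topology
open scoped InnerProductSpace ENNReal NNReal

attribute [local instance] Classical.propDecidable

noncomputable section

variable (H : Type) [NormedAddCommGroup H] [InnerProductSpace ℝ H] [CompleteSpace H]
  [SecondCountableTopology H] [MeasurableSpace H] [BorelSpace H]

/-- All data of the framework: the `C₀`-semigroup `e^{tA}` with its generator `A`
(a densely defined unbounded operator), the diffusion operator `C` (symmetric, nonnegative)
with a square root `C^{1/2}`, a Hilbert basis of `H`, the time horizon `T > 0`, and the
Borel measurable drift `F` defined on a Borel set `DF ⊆ [0,T] × H`. -/
structure FPData where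
  T : ℝ
  hT : 0 < T
  S : ℝ → H →L[ℝ] H
  S_zero : S 0 = 1
  S_add : ∀ s t : ℝ, 0 ≤ s → 0 ≤ t → S (s + t) = (S s).comp (S t)
  S_cont : ∀ x : H, ContinuousOn (fun t => S t x) (Ici (0 : ℝ))
  A : H →ₗ.[ℝ] H
  A_dense : Dense (A.domain : Set H)
  A_mem_iff : ∀ x : H, x ∈ A.domain ↔
    ∃ y : H, Tendsto (fun t : ℝ => t⁻¹ • (S t x - x)) (𝓝[>] 0) (𝓝 y)
  A_gen : ∀ x : A.domain,
    Tendsto (fun t : ℝ => t⁻¹ • (S t (x : H) - (x : H))) (𝓝[>] 0) (𝓝 (A x))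
  C : H →L[ℝ] H
  C_pos : C.IsPositive
  sqrtC : H →L[ℝ] H
  sqrtC_pos : sqrtC.IsPositive
  sqrtC_sq : sqrtC.comp sqrtC = C
  ι : Type
  basis : HilbertBasis ι ℝ H
  F : ℝ × H → H
  DF : Set (ℝ × H)
  DF_meas : MeasurableSet DF
  F_meas : Measurable F

variable {H}

/-- The spatial gradient `D_x u(t,x)` of a function `u : ℝ × H → ℝ`. -/
def xGrad (u : ℝ × H → ℝ) (p : ℝ × H) : H :=
  gradient (fun z => u (p.1, z)) p.2

/-- The set `Sf` of functions is dense in `L¹([s,T] × H, μ)`. -/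
def DenseRangeL1 (μ : Measure (ℝ × H)) (Sf : Set (ℝ × H → ℝ)) : Prop :=
  ∀ f : ℝ × H → ℝ, Integrable f μ → ∀ ε > 0,
    ∃ g ∈ Sf, Integrable g μ ∧ ∫ p, |f p - g p| ∂μ < ε

namespace FPData

variable (D : FPData H)

/-- `h ∈ C¹([0,T]; D(A*))`, represented by the pair `(h, g)` with `g t = A* (h t)`. -/
def CinDAstar (h g : ℝ → H) : Prop :=
  ContDiffOn ℝ 1 h (Icc 0 D.T) ∧ ContDiffOn ℝ 1 g (Icc 0 D.T) ∧
    ∀ t ∈ Icc 0 D.T, (h t, g t) ∈ D.A.adjoint.graph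

/-- Generators of `E_A([0,T] × H)`: real parts of `φ(t) e^{i⟨x, h(t)⟩}`. -/
def EAgen : Set (ℝ × H → ℝ) :=
  {u | ∃ (φ : ℝ → ℝ) (h g : ℝ → H), ContDiffOn ℝ 1 φ (Icc 0 D.T) ∧ φ D.T = 0 ∧
    D.CinDAstar h g ∧
    (u = (fun p => φ p.1 * Real.cos ⟪p.2, h p.1⟫_ℝ) ∨
     u = (fun p => φ p.1 * Real.sin ⟪p.2, h p.1⟫_ℝ))}

/-- The space of test functions `E_A([0,T] × H) = D(L₀)`: the linear span of the generators. -/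
def EA : Set (ℝ × H → ℝ) := ↑(Submodule.span ℝ D.EAgen)

/-- The trace term `Tr[C D²_x u(t,x)] = Σ_i ⟨D²_x u(t,x)(C^{1/2} e_i), C^{1/2} e_i⟩`. -/
def traceCD2 (u : ℝ × H → ℝ) (p : ℝ × H) : ℝ :=
  ∑' i : D.ι,
    ⟪(fderiv ℝ (gradient fun z => u (p.1, z)) p.2) (D.sqrtC (D.basis i)),
      D.sqrtC (D.basis i)⟫_ℝ

/-- The Ornstein–Uhlenbeck part `V₀u = D_t u + (1/2)Tr[C D²_x u] + ⟨x, A* D_x u⟩`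
of the Kolmogorov operator. -/
def Vzero (u : ℝ × H → ℝ) (p : ℝ × H) : ℝ :=
  deriv (fun r => u (r, p.2)) p.1 + (1 / 2) * D.traceCD2 u p +
    (if hk : xGrad u p ∈ D.A.adjoint.domain then ⟪p.2, D.A.adjoint ⟨xGrad u p, hk⟩⟫_ℝ
     else 0)

/-- The Kolmogorov operator `L₀u = V₀u + ⟨F(t,x), D_x u⟩`. -/
def Lzero (u : ℝ × H → ℝ) (p : ℝ × H) : ℝ :=
  D.Vzero u p + ⟪D.F p, xGrad u p⟫_ℝ

/-- `|F(t,x)|`, with the convention `|F(t,x)| = +∞` outside `D(F)`. -/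
def FnormE (p : ℝ × H) : ℝ≥0∞ := if p ∈ D.DF then (‖D.F p‖₊ : ℝ≥0∞) else ⊤

/-- Condition (1.6): `∫ (|⟨y, A*h(t)⟩| + |F(t,y)|) dμ < ∞` for all `h ∈ C¹([0,T]; D(A*))`. -/
def DriftIntegrable (μ : Measure (ℝ × H)) : Prop :=
  ∀ h g : ℝ → H, D.CinDAstar h g →
    ∫⁻ p, ((‖⟪p.2, g p.1⟫_ℝ‖₊ : ℝ≥0∞) + D.FnormE p) ∂μ < ⊤

/-- `μ(dt,dx) = μ_t(dx) dt` on `[s,T] × H` for a measurable kernel `(μ_t)`. -/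
def IsKernel (s : ℝ) (μ : Measure (ℝ × H)) (μt : ℝ → Measure H) : Prop :=
  (∀ B : Set H, MeasurableSet B → Measurable fun t => μt t B) ∧
  ∀ E : Set (ℝ × H), MeasurableSet E → μ E = ∫⁻ t in Icc s D.T, μt t {x | (t, x) ∈ E}

/-- `μ = μ_t dt` is a solution of the Fokker–Planck equation (1.5) with initial condition
`ζ` at time `s` (membership in `M_{s,ζ}`). -/
def IsFPSol (s : ℝ) (ζ : Measure H) (μ : Measure (ℝ × H)) (μt : ℝ → Measure H) : Prop :=
  (∀ t ∈ Icc s D.T, IsProbabilityMeasure (μt t)) ∧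
  D.IsKernel s μ μt ∧ D.DriftIntegrable μ ∧
  ∀ u ∈ D.EA, ∀ᵐ t ∂(volume.restrict (Icc s D.T)),
    ∫ y, u (t, y) ∂(μt t) =
      ∫ y, u (s, y) ∂ζ + ∫ r in Icc s t, (∫ y, D.Lzero u (r, y) ∂(μt r))

/-- The set `M_{s,ζ}` of solutions of the Fokker–Planck equation. -/
def Mset (s : ℝ) (ζ : Measure H) : Set (Measure (ℝ × H)) :=
  {μ | ∃ μt : ℝ → Measure H, D.IsFPSol s ζ μ μt}

/-- Membership in `M_s^λ` (formula (4.2)): `ν = ν_t dt` is a finite nonnegative measure with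
`∫ L₀ u dν ≤ 2λ ∫ u dν` for all nonnegative `u ∈ E_A`. -/
def IsSubInv (lam s : ℝ) (ν : Measure (ℝ × H)) (νt : ℝ → Measure H) : Prop :=
  (∀ t ∈ Icc s D.T, IsFiniteMeasure (νt t)) ∧
  D.IsKernel s ν νt ∧ D.DriftIntegrable ν ∧
  ∀ u ∈ D.EA, (∀ p : ℝ × H, p.1 ∈ Icc 0 D.T → 0 ≤ u p) →
    ∫ t in Icc s D.T, (∫ y, D.Lzero u (t, y) ∂(νt t)) ≤
      2 * lam * ∫ t in Icc s D.T, (∫ y, u (t, y) ∂(νt t))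

/-- The moment condition `∫_s^T ∫_H (|x|⁴ + |F(t,x)|² + |x|⁴|F(t,x)|²) ν_t(dx) dt < ∞`. -/
def moment2 (s : ℝ) (νt : ℝ → Measure H) : Prop :=
  ∫⁻ t in Icc s D.T, (∫⁻ y, (ENNReal.ofReal (‖y‖ ^ 4) + (D.FnormE (t, y)) ^ 2 +
    ENNReal.ofReal (‖y‖ ^ 4) * (D.FnormE (t, y)) ^ 2) ∂(νt t)) < ⊤

/-- The moment condition `∫_s^T ∫_H (|x|² + |F(t,x)| + |x|²|F(t,x)|) ν_t(dx) dt < ∞`. -/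
def moment1 (s : ℝ) (νt : ℝ → Measure H) : Prop :=
  ∫⁻ t in Icc s D.T, (∫⁻ y, (ENNReal.ofReal (‖y‖ ^ 2) + D.FnormE (t, y) +
    ENNReal.ofReal (‖y‖ ^ 2) * D.FnormE (t, y)) ∂(νt t)) < ⊤

/-- Hypothesis 3.1: dissipativity of `A`, trace class `Q_t = ∫_0^t e^{sA} C e^{sA*} ds`,
and the smoothing condition `e^{tA}(H) ⊆ Q_t^{1/2}(H)` with `Λ_t := (Q_t^{1/2})^{-1} e^{tA}`
satisfying `∫_0^∞ e^{-λt} ‖Λ_t‖ dt < ∞` for `λ` large enough. -/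
structure Hyp31 where
  ω : ℝ
  A_diss : ∀ x : D.A.domain, ⟪D.A x, (x : H)⟫_ℝ ≤ ω * ‖(x : H)‖ ^ 2
  Q : ℝ → H →L[ℝ] H
  Q_def : ∀ t : ℝ, 0 < t → ∀ x : H,
    Q t x = ∫ r in (0 : ℝ)..t, D.S r (D.C ((ContinuousLinearMap.adjoint (D.S r)) x))
  Q_pos : ∀ t : ℝ, 0 < t → (Q t).IsPositive
  Q_traceClass : ∀ t : ℝ, 0 < t → Summable fun i : D.ι => ⟪Q t (D.basis i), D.basis i⟫_ℝ
  sqrtQ : ℝ → H →L[ℝ] H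
  sqrtQ_pos : ∀ t : ℝ, 0 < t → (sqrtQ t).IsPositive
  sqrtQ_sq : ∀ t : ℝ, 0 < t → (sqrtQ t).comp (sqrtQ t) = Q t
  range_incl : ∀ t : ℝ, 0 < t → Set.range (D.S t) ⊆ Set.range (sqrtQ t)
  Λ : ℝ → H →L[ℝ] H
  Λ_spec : ∀ t : ℝ, 0 < t → (sqrtQ t).comp (Λ t) = D.S t
  lam₀ : ℝ
  Λ_int : ∀ lam : ℝ, lam₀ ≤ lam →
    IntegrableOn (fun t => Real.exp (-lam * t) * ‖Λ t‖) (Ioi 0)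

/-- Hypothesis 5.1: `F(t,·)` is the minimal section of an `m`-dissipative graph
`F̄(t,·)`, with `F(t,0) = 0`. -/
structure Hyp51 where
  Fbar : ℝ → H → Set H
  dom_meas : ∀ t ∈ Icc 0 D.T, MeasurableSet {x : H | (Fbar t x).Nonempty}
  K : ℝ
  K_pos : 0 < K
  diss : ∀ t ∈ Icc 0 D.T, ∀ x y u v : H, u ∈ Fbar t x → v ∈ Fbar t y →
    ⟪u - v, x - y⟫_ℝ ≤ K * ‖x - y‖ ^ 2
  mrange : ∀ t ∈ Icc 0 D.T, ∀ lam : ℝ, K < lam → ∀ z : H,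
    ∃ x : H, ∃ w ∈ Fbar t x, lam • x - w = z
  dom_eq : ∀ t ∈ Icc 0 D.T, ∀ x : H, (t, x) ∈ D.DF ↔ (Fbar t x).Nonempty
  minimal : ∀ t ∈ Icc 0 D.T, ∀ x : H, (t, x) ∈ D.DF →
    D.F (t, x) ∈ Fbar t x ∧ ∀ w ∈ Fbar t x, ‖D.F (t, x)‖ ≤ ‖w‖
  zero_mem : ∀ t ∈ Icc 0 D.T, (t, (0 : H)) ∈ D.DF ∧ D.F (t, 0) = 0

/-- Hypothesis 3.3 for a drift `F₀ : [0,T] × H → H`: continuity, continuous space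
derivative, and uniform Lipschitz continuity in the space variable. -/
def Hyp33 (F0 : ℝ × H → H) : Prop :=
  ContinuousOn F0 (Icc 0 D.T ×ˢ (univ : Set H)) ∧
  (∀ t ∈ Icc 0 D.T, ∀ x : H, DifferentiableAt ℝ (fun y => F0 (t, y)) x) ∧
  (∀ t ∈ Icc 0 D.T, Continuous fun x : H => fderiv ℝ (fun y => F0 (t, y)) x) ∧
  ∃ K > 0, ∀ t ∈ Icc 0 D.T, ∀ x y : H, ‖F0 (t, x) - F0 (t, y)‖ ≤ K * ‖x - y‖

/-- The data of the Ornstein–Uhlenbeck semigroup: the Gaussian measures `N_{Q_t}`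
(specified through their characteristic functionals). -/
structure OUData (hyp : D.Hyp31) where
  N : ℝ → Measure H
  N_prob : ∀ t : ℝ, 0 ≤ t → IsProbabilityMeasure (N t)
  N_zero : N 0 = Measure.dirac 0
  N_char : ∀ t : ℝ, 0 < t → ∀ h : H,
    ∫ x, Complex.exp ((⟪x, h⟫_ℝ : ℂ) * Complex.I) ∂(N t) =
      Complex.exp (-((⟪hyp.Q t h, h⟫_ℝ : ℂ)) / 2)

end FPData

namespace FPData.OUData

variable {H : Type} [NormedAddCommGroup H] [InnerProductSpace ℝ H] [CompleteSpace H]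
  [SecondCountableTopology H] [MeasurableSpace H] [BorelSpace H]
  {D : FPData H} {hyp : D.Hyp31}

/-- The Ornstein–Uhlenbeck semigroup `R_t φ(x) = ∫_H φ(e^{tA} x + y) N_{Q_t}(dy)`. -/
def Rop (O : D.OUData hyp) (t : ℝ) (φ : H → ℝ) (x : H) : ℝ :=
  ∫ y, φ (D.S t x + y) ∂(O.N t)

/-- The resolvent `G̃_λ f(x) = ∫_0^∞ e^{-λt} R_t f(x) dt` of the OU semigroup. -/
def Gtilde (O : D.OUData hyp) (lam : ℝ) (f : H → ℝ) (x : H) : ℝ :=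
  ∫ t in Ioi (0 : ℝ), Real.exp (-lam * t) * O.Rop t f x

/-- The resolvent `G_λ f(t,x) = ∫_t^T e^{-λ(r-t)} R_{r-t} f(r,·)(x) dr` of the
time-dependent OU operator `V`; by definition `u ∈ D(V)` iff `u = G_λ f` for some `λ` and
some `f ∈ C([0,T]; C_{u,2}(H))`, and then `Vu = λu - f`. -/
def Gop (O : D.OUData hyp) (lam : ℝ) (f : ℝ → H → ℝ) (p : ℝ × H) : ℝ :=
  ∫ r in p.1..D.T, Real.exp (-lam * (r - p.1)) * O.Rop (r - p.1) (f r) p.2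

end FPData.OUData

section Spaces

variable {H : Type} [NormedAddCommGroup H] [InnerProductSpace ℝ H] [CompleteSpace H]

/-- Membership in `C_{u,2}(H)`: `x ↦ φ(x)/(1+|x|²)` is uniformly continuous and bounded. -/
def MemCu2 (φ : H → ℝ) : Prop :=
  UniformContinuous (fun x : H => φ x / (1 + ‖x‖ ^ 2)) ∧
    ∃ M : ℝ, ∀ x : H, |φ x| ≤ M * (1 + ‖x‖ ^ 2)

/-- The norm of `C_{u,2}(H)`: `‖φ‖ = sup_x |φ(x)|/(1+|x|²)`. -/
def cu2Norm (φ : H → ℝ) : ℝ := ⨆ x : H, |φ x| / (1 + ‖x‖ ^ 2)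

/-- The sup norm `‖f‖_∞ = sup_x |f(x)|`. -/
def supNorm (f : H → ℝ) : ℝ := ⨆ x : H, |f x|

/-- Membership in `C¹_u(H)`: bounded and uniformly continuous together with the
(Fréchet) derivative. -/
def MemC1u (φ : H → ℝ) : Prop :=
  UniformContinuous φ ∧ (∃ M : ℝ, ∀ x : H, |φ x| ≤ M) ∧ Differentiable ℝ φ ∧
    UniformContinuous (gradient φ) ∧ ∃ M : ℝ, ∀ x : H, ‖gradient φ x‖ ≤ M

/-- Membership in `C_u(H,H)`: bounded and uniformly continuous `H → H`. -/
def MemCuHH (Φ : H → H) : Prop := UniformContinuous Φ ∧ ∃ M : ℝ, ∀ x : H, ‖Φ x‖ ≤ M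

end Spaces

namespace FPData

variable {H : Type} [NormedAddCommGroup H] [InnerProductSpace ℝ H] [CompleteSpace H]
  [SecondCountableTopology H] [MeasurableSpace H] [BorelSpace H] (D : FPData H)

/-- Membership in `C([0,T]; C_{u,2}(H))`. -/
def MemCT (f : ℝ → H → ℝ) : Prop :=
  (∀ t ∈ Icc 0 D.T, MemCu2 (f t)) ∧
  ∀ t₀ ∈ Icc 0 D.T, ∀ ε > 0, ∃ δ > 0, ∀ t ∈ Icc 0 D.T, |t - t₀| < δ →
    ∀ x : H, |f t x - f t₀ x| ≤ ε * (1 + ‖x‖ ^ 2)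

/-- Membership in `C([0,T]; C¹_u(H))`. -/
def MemCTC1u (f : ℝ → H → ℝ) : Prop :=
  (∀ t ∈ Icc 0 D.T, MemC1u (f t)) ∧
  ∀ t₀ ∈ Icc 0 D.T, ∀ ε > 0, ∃ δ > 0, ∀ t ∈ Icc 0 D.T, |t - t₀| < δ →
    ∀ x : H, |f t x - f t₀ x| + ‖gradient (f t) x - gradient (f t₀) x‖ ≤ ε

/-- `D_x u ∈ C([0,T]; C_u(H,H))`. -/
def GradInCTCuHH (u : ℝ × H → ℝ) : Prop :=
  (∀ t ∈ Icc 0 D.T, MemCuHH fun x : H => xGrad u (t, x)) ∧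
  ∀ t₀ ∈ Icc 0 D.T, ∀ ε > 0, ∃ δ > 0, ∀ t ∈ Icc 0 D.T, |t - t₀| < δ →
    ∀ x : H, ‖xGrad u (t, x) - xGrad u (t₀, x)‖ ≤ ε

end FPData

end

noncomputable section OrnsteinUhlenbeckGenerator

set_option linter.unusedSectionVars false

open MeasureTheory Set Filter Topology
open scoped InnerProductSpace ENNReal NNReal

variable {H : Type} [NormedAddCommGroup H] [InnerProductSpace ℝ H] [CompleteSpace H]
  [SecondCountableTopology H] [MeasurableSpace H] [BorelSpace H]

namespace FPData

variable (D : FPData H)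

/-- The semigroup `e^{tA}`, extended to negative times by the identity. -/
def sg (t : ℝ) : H →L[ℝ] H := D.S (max t 0)

/-- The relation `h ∈ D(A*)` and `A* h = k`. -/
def AdjointPair (h k : H) : Prop := ∀ x : D.A.domain, ⟪D.A x, h⟫_ℝ = ⟪(x : H), k⟫_ℝ

/-- The orbit `t ↦ e^{tA*} h` of the adjoint semigroup. -/
def adjOrbit (h : H) (t : ℝ) : H := ContinuousLinearMap.adjoint (D.sg t) h

variable {D}

lemma sg_of_nonneg {t : ℝ} (ht : 0 ≤ t) : D.sg t = D.S t := by simp [sg, ht]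

lemma sg_zero : D.sg 0 = 1 := by rw [sg_of_nonneg le_rfl, D.S_zero]

lemma sg_add {s t : ℝ} (hs : 0 ≤ s) (ht : 0 ≤ t) (x : H) :
    D.sg (s + t) x = D.sg s (D.sg t x) := by
  rw [sg_of_nonneg hs, sg_of_nonneg ht, sg_of_nonneg (add_nonneg hs ht), D.S_add s t hs ht]
  rfl

lemma continuous_sg_apply (x : H) : Continuous fun t => D.sg t x :=
  (D.S_cont x).comp_continuous (continuous_id.max continuous_const) fun t => le_max_right t 0

lemma exists_norm_sg_le (b : ℝ) : ∃ M : ℝ, 0 ≤ M ∧ ∀ t ≤ b, ‖D.sg t‖ ≤ M := by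
  have hpt : ∀ x : H, ∃ C, ∀ i : Icc 0 (max b 0), ‖D.sg i x‖ ≤ C := fun x => by
    obtain ⟨C, hC⟩ := isCompact_Icc.exists_bound_of_continuousOn
      ((continuous_sg_apply (D := D) x).continuousOn (s := Icc 0 (max b 0)))
    exact ⟨C, fun i => hC i i.2⟩
  obtain ⟨M, hM⟩ := banach_steinhaus hpt
  have h0 : (0 : ℝ) ≤ max b 0 := le_max_right _ _
  refine ⟨M, (norm_nonneg _).trans (hM ⟨0, le_rfl, h0⟩), fun t ht => ?_⟩
  have := hM ⟨max t 0, le_max_right _ _, max_le_max_right 0 ht⟩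
  simpa [sg] using this

lemma continuous_sg_apply_of_continuous {w : ℝ → H} (hw : Continuous w) :
    Continuous fun t => D.sg t (w t) := by
  refine continuous_iff_continuousAt.2 fun s => ?_
  obtain ⟨M, -, hM⟩ := exists_norm_sg_le (D := D) (s + 1)
  have h1 : Tendsto (fun t => D.sg t (w t - w s)) (𝓝 s) (𝓝 0) := by
    refine squeeze_zero_norm' (a := fun t => M * ‖w t - w s‖) ?_ ?_
    · filter_upwards [Iio_mem_nhds (lt_add_one s)] with t ht
      exact (D.sg t).le_of_opNorm_le (hM t (le_of_lt ht)) _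
    · have : Continuous fun t => M * ‖w t - w s‖ := by fun_prop
      simpa using this.tendsto s
  have h2 : Tendsto (fun t => D.sg t (w s)) (𝓝 s) (𝓝 (D.sg s (w s))) :=
    (continuous_sg_apply (w s)).tendsto s
  have h3 := h1.add h2
  rw [zero_add] at h3
  exact h3.congr fun t => by simp [map_sub]

lemma tendsto_sg_generator (x : D.A.domain) {t : ℝ} (ht : 0 ≤ t) :
    Tendsto (fun r : ℝ => r⁻¹ • (D.S r (D.sg t x) - D.sg t x)) (𝓝[>] 0)
      (𝓝 (D.sg t (D.A x))) := by
  refine (((D.sg t).continuous.tendsto _).comp (D.A_gen x)).congr' ?_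
  filter_upwards [self_mem_nhdsWithin] with r hr
  have hr' : (0 : ℝ) ≤ r := le_of_lt hr
  have hcomm : D.sg t (D.S r (x : H)) = D.S r (D.sg t (x : H)) := by
    rw [← sg_of_nonneg hr', ← sg_add ht hr', add_comm, sg_add hr' ht]
  simp [hcomm]

lemma sg_mem_domain (x : D.A.domain) {t : ℝ} (ht : 0 ≤ t) : D.sg t x ∈ D.A.domain :=
  (D.A_mem_iff _).2 ⟨_, tendsto_sg_generator x ht⟩

lemma generator_sg (x : D.A.domain) {t : ℝ} (ht : 0 ≤ t) :
    D.A ⟨D.sg t x, sg_mem_domain x ht⟩ = D.sg t (D.A x) :=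
  tendsto_nhds_unique (D.A_gen ⟨D.sg t x, sg_mem_domain x ht⟩) (tendsto_sg_generator x ht)

lemma hasDerivWithinAt_sg (x : D.A.domain) {t : ℝ} (ht : 0 ≤ t) :
    HasDerivWithinAt (fun r => D.sg r (x : H)) (D.sg t (D.A x)) (Ioi t) t := by
  rw [hasDerivWithinAt_iff_tendsto_slope' self_notMem_Ioi]
  have hmap : Tendsto (fun r => r - t) (𝓝[>] t) (𝓝[>] 0) := by
    refine tendsto_nhdsWithin_of_tendsto_nhds_of_eventually_within _ ?_ ?_
    · have : Continuous fun r : ℝ => r - t := by fun_prop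
      simpa using (this.tendsto t).mono_left nhdsWithin_le_nhds
    · filter_upwards [self_mem_nhdsWithin] with r hr
      exact mem_Ioi.2 (sub_pos.2 (mem_Ioi.1 hr))
  refine ((tendsto_sg_generator x ht).comp hmap).congr' ?_
  filter_upwards [self_mem_nhdsWithin] with r hr
  have hr' : 0 ≤ r - t := sub_nonneg.2 (le_of_lt hr)
  simp only [Function.comp, slope, vsub_eq_sub]
  rw [← sg_of_nonneg hr', ← sg_add hr' ht, sub_add_cancel]

lemma inner_sg (x h : H) (t : ℝ) : ⟪D.sg t x, h⟫_ℝ = ⟪x, D.adjOrbit h t⟫_ℝ :=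
  (ContinuousLinearMap.adjoint_inner_right _ _ _).symm

lemma AdjointPair.adjOrbit {h k : H} (hk : D.AdjointPair h k) {t : ℝ} (ht : 0 ≤ t) :
    D.AdjointPair (D.adjOrbit h t) (D.adjOrbit k t) := fun x => by
  rw [← inner_sg, ← inner_sg, ← generator_sg x ht]
  exact hk _

lemma adjOrbit_add (h : H) {s t : ℝ} (hs : 0 ≤ s) (ht : 0 ≤ t) :
    D.adjOrbit h (s + t) = D.adjOrbit (D.adjOrbit h s) t :=
  ext_inner_left ℝ fun x => by
    rw [← inner_sg, ← inner_sg, ← inner_sg, sg_add hs ht]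

lemma norm_adjOrbit_le {M t : ℝ} (hM : ‖D.sg t‖ ≤ M) (h : H) : ‖D.adjOrbit h t‖ ≤ M * ‖h‖ :=
  ContinuousLinearMap.le_of_opNorm_le _
    (by rwa [LinearIsometryEquiv.norm_map]) _

variable {h k : H}

lemma AdjointPair.inner_sg_eq (hk : D.AdjointPair h k) (x : H) {t : ℝ} (ht : 0 ≤ t) :
    ⟪D.sg t x, h⟫_ℝ = ⟪x, h⟫_ℝ + ∫ r in (0 : ℝ)..t, ⟪D.sg r x, k⟫_ℝ := by
  have hcont : ∀ (x y : H), Continuous fun r => ⟪D.sg r x, y⟫_ℝ := fun x y =>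
    (continuous_sg_apply x).inner continuous_const
  have hinteg : ∀ (x : H), IntervalIntegrable (fun r => ⟪D.sg r x, k⟫_ℝ) volume 0 t :=
    fun x => (hcont x k).intervalIntegrable _ _
  refine D.A_dense.induction (P := fun x => ⟪D.sg t x, h⟫_ℝ = ⟪x, h⟫_ℝ +
    ∫ r in (0 : ℝ)..t, ⟪D.sg r x, k⟫_ℝ) (fun x hx => ?_) ?_ x
  · have hd : ∀ r ∈ Ioo 0 t, HasDerivWithinAt (fun r => ⟪D.sg r x, h⟫_ℝ) ⟪D.sg r x, k⟫_ℝ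
        (Ioi r) r := fun r hr => by
      have := (hasDerivWithinAt_sg (⟨x, hx⟩ : D.A.domain) hr.1.le).inner ℝ
        (hasDerivWithinAt_const r (Ioi r) h)
      rw [inner_zero_right, zero_add, ← generator_sg _ hr.1.le, hk] at this
      exact this
    have := intervalIntegral.integral_eq_sub_of_hasDeriv_right
      (hcont x h).continuousOn (by simpa [ht] using hd) (hinteg x)
    rw [this, sg_zero]
    simp
  · refine isClosed_eq (by fun_prop) (Continuous.add (by fun_prop) ?_)
    obtain ⟨M, -, hM⟩ := exists_norm_sg_le (D := D) t
    refine continuous_iff_continuousAt.2 fun y => ?_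
    refine intervalIntegral.continuousAt_of_dominated_interval
      (bound := fun _ => M * (‖y‖ + 1) * ‖k‖) ?_ ?_ (by simp) ?_
    · exact Eventually.of_forall fun x => (hcont x k).aestronglyMeasurable
    · filter_upwards [Metric.ball_mem_nhds y one_pos] with z hz
      refine Eventually.of_forall fun r hr => (norm_inner_le_norm _ _).trans ?_
      rw [uIoc_of_le ht] at hr
      have h1 : ‖z‖ ≤ ‖y‖ + 1 := by
        have := norm_le_norm_add_norm_sub' z y
        rw [Metric.mem_ball, dist_eq_norm] at hz
        linarith
      have h2 := (D.sg r).le_of_opNorm_le (hM r hr.2) z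
      have h3 : 0 ≤ M := (norm_nonneg _).trans (hM r hr.2)
      gcongr
      exact h2.trans (by gcongr)
    · exact Eventually.of_forall fun r _ => by fun_prop

lemma AdjointPair.hasDerivAt_inner_sg (hk : D.AdjointPair h k) (x : H) {t : ℝ} (ht : 0 < t) :
    HasDerivAt (fun r => ⟪D.sg r x, h⟫_ℝ) ⟪D.sg t x, k⟫_ℝ t := by
  have hc : Continuous fun r => ⟪D.sg r x, k⟫_ℝ :=
    (continuous_sg_apply x).inner continuous_const
  have h1 := (intervalIntegral.integral_hasDerivAt_right (hc.intervalIntegrable 0 t)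
    hc.aestronglyMeasurable.stronglyMeasurableAtFilter hc.continuousAt).const_add ⟪x, h⟫_ℝ
  refine h1.congr_of_eventuallyEq ?_
  filter_upwards [Ioi_mem_nhds ht] with r hr
  exact hk.inner_sg_eq x (le_of_lt hr)

lemma AdjointPair.exists_norm_adjOrbit_sub_le (hk : D.AdjointPair h k) (b : ℝ) :
    ∃ L : ℝ, 0 ≤ L ∧ ∀ s ≤ b, ∀ t ≤ b, ‖D.adjOrbit h s - D.adjOrbit h t‖ ≤ L * |s - t| := by
  obtain ⟨M, hM0, hM⟩ := exists_norm_sg_le (D := D) (max b 0)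
  refine ⟨M * ‖k‖, by positivity, fun s hs t ht => ?_⟩
  have hmax : ∀ r, D.adjOrbit h r = D.adjOrbit h (max r 0) := fun r => by
    rw [FPData.adjOrbit, FPData.adjOrbit, sg, sg, max_eq_left (le_max_right r 0)]
  have hinteg : ∀ (x : H) (a b : ℝ), IntervalIntegrable (fun r => ⟪D.sg r x, k⟫_ℝ) volume a b :=
    fun x a b => ((continuous_sg_apply x).inner continuous_const).intervalIntegrable _ _
  refine ContinuousLinearMap.opNorm_le_bound (innerSL ℝ (D.adjOrbit h s - D.adjOrbit h t))
    (by positivity) (fun x => ?_) |>.trans' (by rw [innerSL_apply_norm])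
  have key : ⟪x, D.adjOrbit h s - D.adjOrbit h t⟫_ℝ =
      ∫ r in (max t 0)..(max s 0), ⟪D.sg r x, k⟫_ℝ := by
    rw [hmax s, hmax t, inner_sub_right, ← inner_sg, ← inner_sg,
      hk.inner_sg_eq x (le_max_right s 0), hk.inner_sg_eq x (le_max_right t 0),
      ← intervalIntegral.integral_interval_sub_left (hinteg x 0 (max s 0)) (hinteg x 0 (max t 0))]
    ring
  rw [innerSL_apply_apply, real_inner_comm, key]
  have hle := intervalIntegral.norm_integral_le_of_norm_le_const (a := max t 0) (b := max s 0)
    (f := fun r => ⟪D.sg r x, k⟫_ℝ) (C := M * ‖x‖ * ‖k‖) fun r hr => by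
      refine (norm_inner_le_norm _ _).trans ?_
      gcongr
      refine (D.sg r).le_of_opNorm_le (hM r (hr.2.trans ?_)) x
      exact max_le (max_le_max_right 0 ht) (max_le_max_right 0 hs)
  have habs : |max s 0 - max t 0| ≤ |s - t| := abs_max_sub_max_le_abs s t 0
  calc _ ≤ _ := hle
    _ ≤ M * ‖x‖ * ‖k‖ * |s - t| := by gcongr
    _ = _ := by ring

lemma AdjointPair.continuous_adjOrbit (hk : D.AdjointPair h k) : Continuous (D.adjOrbit h) := by
  refine continuous_iff_continuousAt.2 fun s => ?_
  obtain ⟨L, -, hL⟩ := hk.exists_norm_adjOrbit_sub_le (s + 1)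
  refine tendsto_iff_norm_sub_tendsto_zero.2 ?_
  refine squeeze_zero' (g := fun t => L * |t - s|) (Eventually.of_forall fun _ => norm_nonneg _)
    ?_ ?_
  · filter_upwards [Iio_mem_nhds (lt_add_one s)] with t ht
    exact hL t (le_of_lt ht) s (by linarith)
  · have : Continuous fun t => L * |t - s| := by fun_prop
    simpa using this.tendsto s

/-- The function `t ↦ ⟨C e^{tA*} h, e^{tA*} h⟩`. -/
def diffusionForm (D : FPData H) (h : H) (t : ℝ) : ℝ := ⟪D.C (D.adjOrbit h t), D.adjOrbit h t⟫_ℝ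

lemma diffusionForm_nonneg (t : ℝ) : 0 ≤ D.diffusionForm h t :=
  D.C_pos.inner_nonneg_left _

lemma diffusionForm_zero : D.diffusionForm h 0 = ⟪D.C h, h⟫_ℝ := by
  have : D.adjOrbit h 0 = h := ext_inner_left ℝ fun x => by rw [← inner_sg, sg_zero]; rfl
  rw [diffusionForm, this]

lemma AdjointPair.continuous_diffusionForm (hk : D.AdjointPair h k) :
    Continuous (D.diffusionForm h) :=
  (D.C.continuous.comp hk.continuous_adjOrbit).inner hk.continuous_adjOrbit

lemma AdjointPair.hasDerivAt_diffusionForm (hk : D.AdjointPair h k) {t : ℝ} (ht : 0 < t) :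
    HasDerivAt (D.diffusionForm h) (2 * ⟪D.sg t (D.C (D.adjOrbit h t)), k⟫_ℝ) t := by
  set u := D.adjOrbit h with hu
  obtain ⟨L, hL0, hL⟩ := hk.exists_norm_adjOrbit_sub_le (t + 1)
  have h1 : HasDerivAt (fun s => ⟪D.C (u s - u t), u s - u t⟫_ℝ) 0 t := by
    have hO : (fun s => ⟪D.C (u s - u t), u s - u t⟫_ℝ) =O[𝓝 t] fun s => ‖s - t‖ ^ 2 := by
      refine Asymptotics.IsBigO.of_bound (‖D.C‖ * L ^ 2) ?_
      filter_upwards [Iio_mem_nhds (lt_add_one t)] with s hs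
      have h2 := hL s (le_of_lt hs) t (by linarith)
      have h3 := (norm_inner_le_norm (𝕜 := ℝ) (D.C (u s - u t)) (u s - u t))
      have h4 := D.C.le_opNorm (u s - u t)
      rw [norm_pow, norm_norm, Real.norm_eq_abs (s - t)]
      calc _ ≤ _ := h3
        _ ≤ ‖D.C‖ * ‖u s - u t‖ * ‖u s - u t‖ := by gcongr
        _ ≤ ‖D.C‖ * (L * |s - t|) * (L * |s - t|) := by gcongr
        _ = _ := by ring
    have := (hO.hasFDerivAt (𝕜 := ℝ) one_lt_two).hasDerivAt
    simpa using this
  have h2 := (hk.hasDerivAt_inner_sg (D.C (u t)) ht).const_mul 2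
  have h3 := (h1.add h2).sub_const ⟪D.C (u t), u t⟫_ℝ
  rw [zero_add] at h3
  refine h3.congr_of_eventuallyEq (Eventually.of_forall fun s => ?_)
  have hsym : ⟪D.C (u s), u t⟫_ℝ = ⟪D.C (u t), u s⟫_ℝ := by
    rw [real_inner_comm]; exact (D.C_pos.isSymmetric (u t) (u s)).symm
  simp only [Pi.add_apply, diffusionForm, inner_sg, ← hu, map_sub, inner_sub_left,
    inner_sub_right, hsym]
  ring

/-- The variance `⟨Q_t h, h⟩ = ∫_0^t ⟨C e^{rA*} h, e^{rA*} h⟩ dr`. -/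
def orbitVariance (D : FPData H) (h : H) (t : ℝ) : ℝ := ∫ r in (0 : ℝ)..t, D.diffusionForm h r

lemma orbitVariance_nonneg {t : ℝ} (ht : 0 ≤ t) : 0 ≤ D.orbitVariance h t :=
  intervalIntegral.integral_nonneg ht fun r _ => diffusionForm_nonneg r

lemma AdjointPair.orbitVariance_mono (hk : D.AdjointPair h k) {s t : ℝ} (hs : 0 ≤ s)
    (hst : s ≤ t) : D.orbitVariance h s ≤ D.orbitVariance h t :=
  intervalIntegral.integral_mono_interval le_rfl hs hst
    (Eventually.of_forall fun r => diffusionForm_nonneg r)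
    (hk.continuous_diffusionForm.intervalIntegrable _ _)

lemma AdjointPair.hasDerivAt_orbitVariance (hk : D.AdjointPair h k) (t : ℝ) :
    HasDerivAt (D.orbitVariance h) (D.diffusionForm h t) t :=
  hk.continuous_diffusionForm.integral_hasStrictDerivAt 0 t |>.hasDerivAt

lemma AdjointPair.orbitVariance_adjOrbit_le (hk : D.AdjointPair h k) {s t : ℝ} (hs : 0 ≤ s)
    (ht : 0 ≤ t) : D.orbitVariance (D.adjOrbit h s) t ≤ D.orbitVariance h (s + t) := by
  have hshift : D.orbitVariance (D.adjOrbit h s) t =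
      ∫ r in (0 : ℝ)..t, D.diffusionForm h (s + r) := by
    refine intervalIntegral.integral_congr fun r hr => ?_
    rw [uIcc_of_le ht] at hr
    simp only [diffusionForm, adjOrbit_add h hs hr.1]
  rw [hshift, intervalIntegral.integral_comp_add_left, add_zero]
  exact intervalIntegral.integral_mono_interval hs (by linarith) le_rfl
    (Eventually.of_forall fun r => diffusionForm_nonneg r)
    (hk.continuous_diffusionForm.intervalIntegrable _ _)

lemma AdjointPair.inner_Q (hyp : D.Hyp31) (hk : D.AdjointPair h k) (y : H) {t : ℝ} (ht : 0 < t) :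
    ⟪hyp.Q t h, y⟫_ℝ = ∫ r in (0 : ℝ)..t, ⟪D.sg r (D.C (D.adjOrbit h r)), y⟫_ℝ := by
  have hcont : Continuous fun r => D.sg r (D.C (D.adjOrbit h r)) :=
    continuous_sg_apply_of_continuous (D.C.continuous.comp hk.continuous_adjOrbit)
  have hQ : hyp.Q t h = ∫ r in (0 : ℝ)..t, D.sg r (D.C (D.adjOrbit h r)) := by
    rw [hyp.Q_def t ht]
    refine intervalIntegral.integral_congr fun r hr => ?_
    rw [uIcc_of_le ht.le] at hr
    simp only [FPData.adjOrbit, sg_of_nonneg hr.1]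
  rw [hQ, real_inner_comm]
  have := (innerSL ℝ y).intervalIntegral_comp_comm (hcont.intervalIntegrable (μ := volume) 0 t)
  simp only [innerSL_apply_apply] at this
  rw [← this]
  simp only [real_inner_comm]

lemma AdjointPair.inner_Q_self (hyp : D.Hyp31) (hk : D.AdjointPair h k) {t : ℝ} (ht : 0 < t) :
    ⟪hyp.Q t h, h⟫_ℝ = D.orbitVariance h t := by
  rw [hk.inner_Q hyp h ht]
  simp only [inner_sg]
  rfl

lemma AdjointPair.diffusionForm_eq (hyp : D.Hyp31) (hk : D.AdjointPair h k) {t : ℝ} (ht : 0 < t) :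
    D.diffusionForm h t = ⟪D.C h, h⟫_ℝ + 2 * ⟪hyp.Q t h, k⟫_ℝ := by
  have hcont : Continuous fun r => ⟪D.sg r (D.C (D.adjOrbit h r)), k⟫_ℝ :=
    (continuous_sg_apply_of_continuous
      (D.C.continuous.comp hk.continuous_adjOrbit)).inner continuous_const
  have := intervalIntegral.integral_eq_sub_of_hasDerivAt_of_le ht.le
    hk.continuous_diffusionForm.continuousOn
    (fun r hr => hk.hasDerivAt_diffusionForm hr.1)
    ((hcont.const_mul 2).intervalIntegrable _ _)
  rw [intervalIntegral.integral_const_mul, ← hk.inner_Q hyp k ht, diffusionForm_zero] at this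
  linarith

lemma norm_sqrtQ_sq (hyp : D.Hyp31) {t : ℝ} (ht : 0 < t) (w : H) :
    ‖hyp.sqrtQ t w‖ ^ 2 = ⟪hyp.Q t w, w⟫_ℝ := by
  rw [← hyp.sqrtQ_sq t ht, ← real_inner_self_eq_norm_sq]
  exact ((hyp.sqrtQ_pos t ht).isSymmetric (hyp.sqrtQ t w) w).symm

lemma norm_adjOrbit_le_sqrtQ (hyp : D.Hyp31) {t : ℝ} (ht : 0 < t) (w : H) :
    ‖D.adjOrbit w t‖ ≤ ‖hyp.Λ t‖ * ‖hyp.sqrtQ t w‖ := by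
  have : D.adjOrbit w t = ContinuousLinearMap.adjoint (hyp.Λ t) (hyp.sqrtQ t w) :=
    ext_inner_left ℝ fun x => by
      rw [ContinuousLinearMap.adjoint_inner_right, ← inner_sg, sg_of_nonneg ht.le,
        ← hyp.Λ_spec t ht]
      exact (hyp.sqrtQ_pos t ht).isSymmetric _ _
  rw [this]
  exact ContinuousLinearMap.le_of_opNorm_le _ (LinearIsometryEquiv.norm_map _ _).le _

lemma exists_inner_sq_le (f : H) {ε : ℝ} (hε : 0 < ε) :
    ∃ c : ℝ, 0 ≤ c ∧ ∀ u v : H, D.AdjointPair u v → ⟪v, f⟫_ℝ ^ 2 ≤ ε * ‖v‖ ^ 2 + c * ‖u‖ ^ 2 := by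
  obtain ⟨a, ha, haf⟩ := Metric.dense_iff.1 D.A_dense f (Real.sqrt (ε / 2)) (by positivity)
  rw [Metric.mem_ball, dist_comm, dist_eq_norm] at ha
  refine ⟨2 * ‖D.A ⟨a, haf⟩‖ ^ 2, by positivity, fun u v huv => ?_⟩
  have h1 : ⟪v, f⟫_ℝ = ⟪v, f - a⟫_ℝ + ⟪D.A ⟨a, haf⟩, u⟫_ℝ := by
    rw [huv ⟨a, haf⟩, inner_sub_right, real_inner_comm v a]
    ring
  have h2 : ‖f - a‖ ^ 2 ≤ ε / 2 := by
    have := pow_le_pow_left₀ (norm_nonneg _) ha.le 2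
    rwa [Real.sq_sqrt (by positivity)] at this
  have hsq : ∀ x y : H, ⟪x, y⟫_ℝ ^ 2 ≤ ‖x‖ ^ 2 * ‖y‖ ^ 2 := fun x y => by
    rw [← mul_pow, ← sq_abs]
    gcongr
    exact abs_real_inner_le_norm x y
  calc ⟪v, f⟫_ℝ ^ 2 ≤ 2 * ⟪v, f - a⟫_ℝ ^ 2 + 2 * ⟪D.A ⟨a, haf⟩, u⟫_ℝ ^ 2 := by
        rw [h1]; nlinarith [sq_nonneg (⟪v, f - a⟫_ℝ - ⟪D.A ⟨a, haf⟩, u⟫_ℝ)]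
    _ ≤ 2 * (‖v‖ ^ 2 * (ε / 2)) + 2 * (‖D.A ⟨a, haf⟩‖ ^ 2 * ‖u‖ ^ 2) := by
        gcongr
        · exact (hsq _ _).trans (by gcongr)
        · exact hsq _ _
    _ = _ := by ring

/-- An Ehrling-type inequality: since `Q_t^{1/2}` is Hilbert–Schmidt, `Q_t^{1/2} A*` is bounded
relative to the identity up to an arbitrarily small multiple of `A*`. -/
lemma exists_norm_sqrtQ_sq_le (hyp : D.Hyp31) {t : ℝ} (ht : 0 < t) {ε : ℝ} (hε : 0 < ε) :
    ∃ c : ℝ, 0 ≤ c ∧ ∀ u v : H, D.AdjointPair u v →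
      ‖hyp.sqrtQ t v‖ ^ 2 ≤ ε * ‖v‖ ^ 2 + c * ‖u‖ ^ 2 := by
  set f : D.ι → H := fun i => hyp.sqrtQ t (D.basis i) with hf
  have hsum : Summable fun i => ‖f i‖ ^ 2 := by
    simpa only [hf, norm_sqrtQ_sq hyp ht] using hyp.Q_traceClass t ht
  obtain ⟨F, hF⟩ := (tendsto_tsum_compl_atTop_zero (fun i => ‖f i‖ ^ 2)).eventually
    (gt_mem_nhds (half_pos hε)) |>.exists
  have hη : 0 < ε / 2 / (F.card + 1) := by positivity
  choose c hc0 hc using fun i => exists_inner_sq_le (D := D) (f i) hη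
  refine ⟨∑ i ∈ F, c i, Finset.sum_nonneg fun i _ => hc0 i, fun u v huv => ?_⟩
  have hexp : HasSum (fun i => ⟪v, f i⟫_ℝ ^ 2) (‖hyp.sqrtQ t v‖ ^ 2) := by
    rw [← real_inner_self_eq_norm_sq]
    refine (D.basis.hasSum_inner_mul_inner (hyp.sqrtQ t v) (hyp.sqrtQ t v)).congr_fun
      fun i => ?_
    have : ⟪v, f i⟫_ℝ = ⟪hyp.sqrtQ t v, D.basis i⟫_ℝ :=
      ((hyp.sqrtQ_pos t ht).isSymmetric v (D.basis i)).symm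
    rw [this, real_inner_comm (hyp.sqrtQ t v), sq]
  have htail : ∑' i : {i // i ∉ F}, ⟪v, f i⟫_ℝ ^ 2 ≤ ‖v‖ ^ 2 * (ε / 2) := by
    refine le_trans ?_ (mul_le_mul_of_nonneg_left hF.le (sq_nonneg ‖v‖))
    rw [← tsum_mul_left]
    refine Summable.tsum_le_tsum (fun i => ?_) (hexp.summable.subtype _)
      ((hsum.subtype _).mul_left _)
    rw [← mul_pow, ← sq_abs]
    gcongr
    exact abs_real_inner_le_norm _ _
  have hhead : ∑ i ∈ F, ⟪v, f i⟫_ℝ ^ 2 ≤ ε / 2 * ‖v‖ ^ 2 + (∑ i ∈ F, c i) * ‖u‖ ^ 2 := by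
    calc ∑ i ∈ F, ⟪v, f i⟫_ℝ ^ 2
        ≤ ∑ i ∈ F, (ε / 2 / (F.card + 1) * ‖v‖ ^ 2 + c i * ‖u‖ ^ 2) :=
          Finset.sum_le_sum fun i _ => hc i u v huv
      _ = F.card / (F.card + 1) * (ε / 2 * ‖v‖ ^ 2) + (∑ i ∈ F, c i) * ‖u‖ ^ 2 := by
          rw [Finset.sum_add_distrib, Finset.sum_const, nsmul_eq_mul, Finset.sum_mul]
          ring
      _ ≤ 1 * (ε / 2 * ‖v‖ ^ 2) + (∑ i ∈ F, c i) * ‖u‖ ^ 2 := by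
          gcongr
          exact (div_le_one (by positivity)).2 (by linarith)
      _ = _ := by rw [one_mul]
  have hsplit := hexp.summable.sum_add_tsum_compl (s := F)
  rw [hexp.tsum_eq] at hsplit
  have heq : ∑' i : ((F : Set D.ι)ᶜ : Set D.ι), ⟪v, f i⟫_ℝ ^ 2 =
    ∑' i : {i // i ∉ F}, ⟪v, f i⟫_ℝ ^ 2 := rfl
  rw [heq] at hsplit
  linarith

lemma exists_norm_adjOrbit_one_sq_le (hyp : D.Hyp31) {ε : ℝ} (hε : 0 < ε) :
    ∃ c : ℝ, 0 ≤ c ∧ ∀ u v : H, D.AdjointPair u v →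
      ‖D.adjOrbit v 1‖ ^ 2 ≤ ε * ‖v‖ ^ 2 + c * ‖u‖ ^ 2 := by
  set m := ‖hyp.Λ 1‖ ^ 2 with hm
  have hm0 : 0 ≤ m := sq_nonneg _
  obtain ⟨c, hc0, hc⟩ := exists_norm_sqrtQ_sq_le hyp one_pos
    (show 0 < ε / (m + 1) by positivity)
  refine ⟨m * c, by positivity, fun u v huv => ?_⟩
  calc ‖D.adjOrbit v 1‖ ^ 2 ≤ (‖hyp.Λ 1‖ * ‖hyp.sqrtQ 1 v‖) ^ 2 := by
        gcongr; exact norm_adjOrbit_le_sqrtQ hyp one_pos v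
    _ = m * ‖hyp.sqrtQ 1 v‖ ^ 2 := by rw [mul_pow]
    _ ≤ m * (ε / (m + 1) * ‖v‖ ^ 2 + c * ‖u‖ ^ 2) := by gcongr; exact hc u v huv
    _ = m / (m + 1) * (ε * ‖v‖ ^ 2) + m * c * ‖u‖ ^ 2 := by ring
    _ ≤ 1 * (ε * ‖v‖ ^ 2) + m * c * ‖u‖ ^ 2 := by
        gcongr
        exact (div_le_one (by positivity)).2 (by linarith)
    _ = _ := by rw [one_mul]

/-- The orbit of `h` is controlled by the variance `⟨Q_t h, h⟩`. -/
lemma AdjointPair.exists_norm_adjOrbit_sq_le (hyp : D.Hyp31) (hk : D.AdjointPair h k) :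
    ∃ B : ℝ, 0 ≤ B ∧ ∀ t : ℝ, 0 ≤ t → ‖D.adjOrbit h t‖ ^ 2 ≤ B * (1 + D.orbitVariance h t) := by
  obtain ⟨M, hM0, hM⟩ := exists_norm_sg_le (D := D) 1
  set B := max ((M * ‖h‖) ^ 2) (‖hyp.Λ 1‖ ^ 2)
  have hB0 : 0 ≤ B := le_max_of_le_right (sq_nonneg _)
  refine ⟨B, hB0, fun t ht => ?_⟩
  have hq := orbitVariance_nonneg (D := D) (h := h) ht
  rcases le_total t 1 with h1 | h1
  · calc ‖D.adjOrbit h t‖ ^ 2 ≤ (M * ‖h‖) ^ 2 := by gcongr; exact norm_adjOrbit_le (hM t h1) h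
      _ ≤ B * 1 := by rw [mul_one]; exact le_max_left _ _
      _ ≤ _ := by gcongr; linarith
  · have ht1 : 0 ≤ t - 1 := sub_nonneg.2 h1
    have hadd := adjOrbit_add (D := D) h ht1 zero_le_one
    rw [sub_add_cancel] at hadd
    have hle := hk.orbitVariance_adjOrbit_le ht1 zero_le_one
    rw [sub_add_cancel, ← (hk.adjOrbit ht1).inner_Q_self hyp one_pos,
      ← norm_sqrtQ_sq hyp one_pos] at hle
    calc ‖D.adjOrbit h t‖ ^ 2
        ≤ (‖hyp.Λ 1‖ * ‖hyp.sqrtQ 1 (D.adjOrbit h (t - 1))‖) ^ 2 := by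
          rw [hadd]; gcongr; exact norm_adjOrbit_le_sqrtQ hyp one_pos _
      _ = ‖hyp.Λ 1‖ ^ 2 * ‖hyp.sqrtQ 1 (D.adjOrbit h (t - 1))‖ ^ 2 := mul_pow _ _ _
      _ ≤ B * (1 + D.orbitVariance h t) := by
          gcongr
          · exact le_max_right _ _
          · linarith

/-- The orbit of `A* h` is controlled by the variance `⟨Q_t h, h⟩`. -/
lemma AdjointPair.exists_norm_adjOrbit_snd_sq_le (hyp : D.Hyp31) (hk : D.AdjointPair h k) :
    ∃ B : ℝ, 0 ≤ B ∧ ∀ t : ℝ, 0 ≤ t → ‖D.adjOrbit k t‖ ^ 2 ≤ B * (1 + D.orbitVariance h t) := by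
  obtain ⟨M, hM0, hM⟩ := exists_norm_sg_le (D := D) 1
  obtain ⟨K, hK0, hK⟩ := hk.exists_norm_adjOrbit_sq_le hyp
  obtain ⟨c, hc0, hc⟩ := exists_norm_adjOrbit_one_sq_le hyp (half_pos one_pos)
  set B := max ((M * ‖k‖) ^ 2) (2 * (c * K))
  have hB0 : 0 ≤ B := le_max_of_le_left (sq_nonneg _)
  have hind : ∀ n : ℕ, ∀ t : ℝ, 0 ≤ t → t ≤ n + 1 →
      ‖D.adjOrbit k t‖ ^ 2 ≤ B * (1 + D.orbitVariance h t) := fun n => by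
    have hbase : ∀ t : ℝ, 0 ≤ t → t ≤ 1 →
        ‖D.adjOrbit k t‖ ^ 2 ≤ B * (1 + D.orbitVariance h t) := fun t ht h1 => by
      have hq := orbitVariance_nonneg (D := D) (h := h) ht
      calc ‖D.adjOrbit k t‖ ^ 2 ≤ (M * ‖k‖) ^ 2 := by
            gcongr; exact norm_adjOrbit_le (hM t h1) k
        _ ≤ B * 1 := by rw [mul_one]; exact le_max_left _ _
        _ ≤ _ := by gcongr; linarith
    induction n with
    | zero => simpa using hbase
    | succ n ih =>
      intro t ht htn
      rcases le_total t 1 with h1 | h1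
      · exact hbase t ht h1
      · have ht1 : 0 ≤ t - 1 := sub_nonneg.2 h1
        have hadd := adjOrbit_add (D := D) k ht1 zero_le_one
        rw [sub_add_cancel] at hadd
        have hq := orbitVariance_nonneg (D := D) (h := h) ht1
        push_cast at htn
        calc ‖D.adjOrbit k t‖ ^ 2
            ≤ 1 / 2 * ‖D.adjOrbit k (t - 1)‖ ^ 2 + c * ‖D.adjOrbit h (t - 1)‖ ^ 2 := by
              rw [hadd]; exact hc _ _ (hk.adjOrbit ht1)
          _ ≤ 1 / 2 * (B * (1 + D.orbitVariance h (t - 1))) +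
                c * (K * (1 + D.orbitVariance h (t - 1))) := by
              gcongr
              · exact ih _ ht1 (by linarith)
              · exact hK _ ht1
          _ = (B + 2 * (c * K)) / 2 * (1 + D.orbitVariance h (t - 1)) := by ring
          _ ≤ (B + B) / 2 * (1 + D.orbitVariance h t) := by
              gcongr
              · exact le_max_right _ _
              · exact hk.orbitVariance_mono ht1 (by linarith)
          _ = _ := by ring
  refine ⟨B, hB0, fun t ht => ?_⟩
  obtain ⟨n, hn⟩ := exists_nat_ge t
  exact hind n t ht (by linarith)

end FPData

section CenteredGaussian

variable {μ : Measure H} [IsProbabilityMeasure μ] {Q : H →L[ℝ] H}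

lemma map_inner_eq_gaussianReal (hQ : Q.IsPositive)
    (hμ : ∀ h : H, charFun μ h = Complex.exp (-(⟪Q h, h⟫_ℝ : ℂ) / 2)) (k : H) :
    μ.map (fun y => ⟪y, k⟫_ℝ) = ProbabilityTheory.gaussianReal 0 (Real.toNNReal ⟪Q k, k⟫_ℝ) := by
  have hmeas : Measurable fun y : H => ⟪y, k⟫_ℝ := by fun_prop
  have : IsProbabilityMeasure (μ.map fun y => ⟪y, k⟫_ℝ) :=
    Measure.isProbabilityMeasure_map hmeas.aemeasurable
  refine Measure.ext_of_charFun (funext fun t => ?_)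
  have h1 : charFun (μ.map fun y => ⟪y, k⟫_ℝ) t = charFun μ (t • k) := by
    rw [charFun_apply_real, charFun_apply, integral_map hmeas.aemeasurable (by fun_prop)]
    simp [inner_smul_right]
  rw [h1, hμ, ProbabilityTheory.charFun_gaussianReal, Real.coe_toNNReal _
    (hQ.inner_nonneg_left k)]
  simp only [map_smul, inner_smul_left, inner_smul_right]
  congr 1
  push_cast
  simp
  ring

lemma integrable_inner_of_charFun (hQ : Q.IsPositive)
    (hμ : ∀ h : H, charFun μ h = Complex.exp (-(⟪Q h, h⟫_ℝ : ℂ) / 2)) (k : H) :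
    Integrable (fun y => ⟪y, k⟫_ℝ) μ := by
  have hmeas : Measurable fun y : H => ⟪y, k⟫_ℝ := by fun_prop
  have h1 := ProbabilityTheory.memLp_id_gaussianReal (μ := 0) (v := Real.toNNReal ⟪Q k, k⟫_ℝ) 1
  rw [← map_inner_eq_gaussianReal hQ hμ k] at h1
  exact (integrable_map_measure (by fun_prop) hmeas.aemeasurable).1 (memLp_one_iff_integrable.1 h1)

lemma integrable_cos_inner_add (h : H) (β : ℝ) :
    Integrable (fun y => Real.cos (⟪y, h⟫_ℝ + β)) μ :=
  Integrable.of_bound (by fun_prop) 1 (Eventually.of_forall fun y => Real.abs_cos_le_one _)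

lemma integrable_sin_inner_add (h : H) (β : ℝ) :
    Integrable (fun y => Real.sin (⟪y, h⟫_ℝ + β)) μ :=
  Integrable.of_bound (by fun_prop) 1 (Eventually.of_forall fun y => Real.abs_sin_le_one _)

lemma integral_cos_inner_add
    (hμ : ∀ h : H, charFun μ h = Complex.exp (-(⟪Q h, h⟫_ℝ : ℂ) / 2)) (h : H) (β : ℝ) :
    ∫ y, Real.cos (⟪y, h⟫_ℝ + β) ∂μ = Real.cos β * Real.exp (-⟪Q h, h⟫_ℝ / 2) := by
  have hinteg : Integrable (fun y => Complex.exp ((⟪y, h⟫_ℝ + β : ℝ) * Complex.I)) μ :=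
    Integrable.of_bound (by fun_prop) 1
      (Eventually.of_forall fun y => (Complex.norm_exp_ofReal_mul_I _).le)
  have h1 : ∫ y, Complex.exp ((⟪y, h⟫_ℝ + β : ℝ) * Complex.I) ∂μ =
      Complex.exp (β * Complex.I) * (Real.exp (-⟪Q h, h⟫_ℝ / 2) : ℝ) := by
    have h2 := hμ h
    rw [charFun_apply] at h2
    push_cast
    rw [← h2, ← integral_const_mul]
    refine integral_congr_ae (Eventually.of_forall fun y => ?_)
    simp only [← Complex.exp_add]
    ring_nf
  have h3 := integral_re hinteg
  simp only [RCLike.re_eq_complex_re, Complex.exp_ofReal_mul_I_re] at h3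
  rw [h3, h1, Complex.re_mul_ofReal, Complex.exp_ofReal_mul_I_re]

lemma integral_sin_inner_add
    (hμ : ∀ h : H, charFun μ h = Complex.exp (-(⟪Q h, h⟫_ℝ : ℂ) / 2)) (h : H) (β : ℝ) :
    ∫ y, Real.sin (⟪y, h⟫_ℝ + β) ∂μ = Real.sin β * Real.exp (-⟪Q h, h⟫_ℝ / 2) := by
  have := integral_cos_inner_add hμ h (β - Real.pi / 2)
  simpa only [← add_sub_assoc, Real.cos_sub_pi_div_two] using this

lemma integral_inner_mul_sin_inner_add (hQ : Q.IsPositive)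
    (hμ : ∀ h : H, charFun μ h = Complex.exp (-(⟪Q h, h⟫_ℝ : ℂ) / 2)) (h k : H) (β : ℝ) :
    Integrable (fun y => ⟪y, k⟫_ℝ * Real.sin (⟪y, h⟫_ℝ + β)) μ ∧
    ∫ y, ⟪y, k⟫_ℝ * Real.sin (⟪y, h⟫_ℝ + β) ∂μ =
      ⟪Q h, k⟫_ℝ * Real.cos β * Real.exp (-⟪Q h, h⟫_ℝ / 2) := by
  obtain ⟨hinteg, hderiv⟩ := hasDerivAt_integral_of_dominated_loc_of_deriv_le (μ := μ)
    (F := fun s y => Real.cos (⟪y, h + s • k⟫_ℝ + β))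
    (F' := fun s y => -Real.sin (⟪y, h + s • k⟫_ℝ + β) * ⟪y, k⟫_ℝ)
    (x₀ := (0 : ℝ)) (s := univ) (bound := fun y => |⟪y, k⟫_ℝ|) univ_mem
    (Eventually.of_forall fun s => (integrable_cos_inner_add _ _).aestronglyMeasurable)
    (integrable_cos_inner_add _ _) (by fun_prop)
    (Eventually.of_forall fun y s _ => by
      rw [norm_mul, norm_neg]
      exact mul_le_of_le_one_left (norm_nonneg _) (Real.abs_sin_le_one _))
    (integrable_inner_of_charFun hQ hμ k).abs
    (Eventually.of_forall fun y s _ => by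
      have : HasDerivAt (fun s : ℝ => ⟪y, h + s • k⟫_ℝ + β) ⟪y, k⟫_ℝ s := by
        simp only [inner_add_right, inner_smul_right]
        simpa using (((hasDerivAt_id s).mul_const ⟪y, k⟫_ℝ).const_add ⟪y, h⟫_ℝ).add_const β
      exact this.cos)
  simp only [zero_smul, add_zero] at hinteg hderiv
  have hsymm : ⟪Q k, h⟫_ℝ = ⟪Q h, k⟫_ℝ := by
    rw [real_inner_comm]; exact (hQ.isSymmetric h k).symm
  have hderiv' : HasDerivAt (fun s : ℝ => ∫ y, Real.cos (⟪y, h + s • k⟫_ℝ + β) ∂μ)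
      (Real.cos β * (Real.exp (-⟪Q h, h⟫_ℝ / 2) * -⟪Q h, k⟫_ℝ)) 0 := by
    simp only [integral_cos_inner_add hμ]
    have hquad : (fun s : ℝ => ⟪Q (h + s • k), h + s • k⟫_ℝ) =
        fun s => ⟪Q h, h⟫_ℝ + s * (2 * ⟪Q h, k⟫_ℝ) + s ^ 2 * ⟪Q k, k⟫_ℝ := by
      ext s
      simp only [map_add, map_smul, inner_add_left, inner_add_right, inner_smul_left,
        inner_smul_right, hsymm]
      simp
      ring
    have hq : HasDerivAt (fun s : ℝ => ⟪Q (h + s • k), h + s • k⟫_ℝ) (2 * ⟪Q h, k⟫_ℝ) 0 := by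
      rw [hquad]
      have := (((hasDerivAt_id (0 : ℝ)).mul_const (2 * ⟪Q h, k⟫_ℝ)).const_add ⟪Q h, h⟫_ℝ).add
        ((hasDerivAt_pow 2 (0 : ℝ)).mul_const ⟪Q k, k⟫_ℝ)
      exact this.congr_deriv (by simp)
    have := ((hq.neg.div_const 2).exp).const_mul (Real.cos β)
    refine this.congr_deriv ?_
    simp only [Pi.neg_apply, zero_smul, add_zero]
    ring
  have heq := hderiv.unique hderiv'
  have hneg : (fun y => ⟪y, k⟫_ℝ * Real.sin (⟪y, h⟫_ℝ + β)) =
      fun y => -(-Real.sin (⟪y, h⟫_ℝ + β) * ⟪y, k⟫_ℝ) := by ext y; ring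
  rw [hneg]
  refine ⟨hinteg.neg, ?_⟩
  rw [integral_neg, heq]
  ring

end CenteredGaussian

section GeneratorSymbol

/-- The function `b cos(⟨x,h⟩ + α) + ⟨x,k⟩ sin(⟨x,h⟩ + α)`, which for `k = A* h` and
`b = λ + ⟨Ch,h⟩ / 2` is `(λ - U) cos(⟨·,h⟩ + α)`. -/
def trigSource (b : ℝ) (h k : H) (α : ℝ) (x : H) : ℝ :=
  b * Real.cos (⟪x, h⟫_ℝ + α) + ⟪x, k⟫_ℝ * Real.sin (⟪x, h⟫_ℝ + α)

lemma abs_inv_one_add_norm_sq_sub_le (x y : H) :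
    |(1 + ‖x‖ ^ 2)⁻¹ - (1 + ‖y‖ ^ 2)⁻¹| * (1 + ‖y‖) ≤ 4 * ‖x - y‖ := by
  have hx : 0 < 1 + ‖x‖ ^ 2 := by positivity
  have hy : 0 < 1 + ‖y‖ ^ 2 := by positivity
  have h1 : (1 + ‖x‖ ^ 2)⁻¹ - (1 + ‖y‖ ^ 2)⁻¹ =
      (‖y‖ - ‖x‖) * (‖y‖ + ‖x‖) / ((1 + ‖x‖ ^ 2) * (1 + ‖y‖ ^ 2)) := by
    field_simp; ring
  have h2 : |‖y‖ - ‖x‖| ≤ ‖x - y‖ := by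
    rw [abs_sub_comm]; exact abs_norm_sub_norm_le x y
  rw [h1, abs_div, abs_mul, abs_of_nonneg (by positivity : 0 ≤ ‖y‖ + ‖x‖),
    abs_of_pos (mul_pos hx hy), div_mul_eq_mul_div, div_le_iff₀ (mul_pos hx hy)]
  have h3 : (‖y‖ + ‖x‖) * (1 + ‖y‖) ≤ 4 * ((1 + ‖x‖ ^ 2) * (1 + ‖y‖ ^ 2)) := by
    nlinarith [sq_nonneg (‖x‖ - 1), sq_nonneg (‖y‖ - 1), sq_nonneg (‖x‖ - ‖y‖),
      mul_nonneg (sq_nonneg ‖x‖) (sq_nonneg ‖y‖)]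
  calc |‖y‖ - ‖x‖| * (‖y‖ + ‖x‖) * (1 + ‖y‖)
      = |‖y‖ - ‖x‖| * ((‖y‖ + ‖x‖) * (1 + ‖y‖)) := by ring
    _ ≤ ‖x - y‖ * (4 * ((1 + ‖x‖ ^ 2) * (1 + ‖y‖ ^ 2))) := by gcongr
    _ = _ := by ring

lemma abs_trigSource_le (b : ℝ) (h k : H) (α : ℝ) (x : H) :
    |trigSource b h k α x| ≤ (|b| + ‖k‖) * (1 + ‖x‖) := by
  have h1 : |b * Real.cos (⟪x, h⟫_ℝ + α)| ≤ |b| * 1 := by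
    rw [abs_mul]; gcongr; exact Real.abs_cos_le_one _
  have h2 : |⟪x, k⟫_ℝ * Real.sin (⟪x, h⟫_ℝ + α)| ≤ ‖x‖ * ‖k‖ * 1 := by
    rw [abs_mul]
    gcongr
    · exact abs_real_inner_le_norm x k
    · exact Real.abs_sin_le_one _
  have h3 := abs_add_le (b * Real.cos (⟪x, h⟫_ℝ + α)) (⟪x, k⟫_ℝ * Real.sin (⟪x, h⟫_ℝ + α))
  have h4 : 0 ≤ |b| * ‖x‖ := by positivity
  rw [trigSource]
  nlinarith [norm_nonneg k]

lemma abs_trigSource_sub_le (b : ℝ) (h k : H) (α : ℝ) (x y : H) :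
    |trigSource b h k α x - trigSource b h k α y| ≤
      (|b| * ‖h‖ + ‖k‖ + ‖k‖ * ‖h‖) * (1 + ‖x‖) * ‖x - y‖ := by
  have hin : ∀ w : H, |⟪x, w⟫_ℝ - ⟪y, w⟫_ℝ| ≤ ‖w‖ * ‖x - y‖ := fun w => by
    rw [← inner_sub_left, mul_comm]; exact abs_real_inner_le_norm _ _
  have hlip : ∀ f : ℝ → ℝ, LipschitzWith 1 f →
      |f (⟪x, h⟫_ℝ + α) - f (⟪y, h⟫_ℝ + α)| ≤ ‖h‖ * ‖x - y‖ := fun f hf => by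
    have := hf.dist_le_mul (⟪x, h⟫_ℝ + α) (⟪y, h⟫_ℝ + α)
    rw [Real.dist_eq, Real.dist_eq, add_sub_add_right_eq_sub, NNReal.coe_one, one_mul] at this
    exact this.trans (hin h)
  have hc := hlip _ Real.lipschitzWith_cos
  have hs := hlip _ Real.lipschitzWith_sin
  have hdecomp : trigSource b h k α x - trigSource b h k α y =
      b * (Real.cos (⟪x, h⟫_ℝ + α) - Real.cos (⟪y, h⟫_ℝ + α)) +
      (⟪x, k⟫_ℝ * (Real.sin (⟪x, h⟫_ℝ + α) - Real.sin (⟪y, h⟫_ℝ + α)) +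
      (⟪x, k⟫_ℝ - ⟪y, k⟫_ℝ) * Real.sin (⟪y, h⟫_ℝ + α)) := by
    simp only [trigSource]; ring
  rw [hdecomp]
  refine (abs_add_three _ _ _).trans ?_ |>.trans' (by rw [add_assoc])
  simp only [abs_mul]
  calc _ ≤ |b| * (‖h‖ * ‖x - y‖) + ‖x‖ * ‖k‖ * (‖h‖ * ‖x - y‖) + ‖k‖ * ‖x - y‖ * 1 := by
        gcongr
        · exact abs_real_inner_le_norm x k
        · exact hin k
        · exact Real.abs_sin_le_one _
    _ ≤ _ := by
        have h1 : 0 ≤ |b| * ‖h‖ * ‖x‖ * ‖x - y‖ := by positivity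
        have h2 : 0 ≤ ‖k‖ * ‖x‖ * ‖x - y‖ := by positivity
        have h3 : 0 ≤ ‖k‖ * ‖h‖ * ‖x - y‖ := by positivity
        nlinarith

lemma one_add_norm_le (x : H) : 1 + ‖x‖ ≤ 2 * (1 + ‖x‖ ^ 2) := by
  nlinarith [sq_nonneg (‖x‖ - 1), sq_nonneg ‖x‖]

lemma memCu2_trigSource (b : ℝ) (h k : H) (α : ℝ) : MemCu2 (trigSource b h k α) := by
  set g := trigSource b h k α with hg
  constructor
  · set L₁ := |b| * ‖h‖ + ‖k‖ + ‖k‖ * ‖h‖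
    set L₂ := |b| + ‖k‖
    have hL : 0 ≤ L₁ * 2 + L₂ * 4 := by positivity
    refine (LipschitzWith.of_dist_le_mul (K := (L₁ * 2 + L₂ * 4).toNNReal)
      fun x y => ?_).uniformContinuous
    rw [Real.dist_eq, dist_eq_norm, Real.coe_toNNReal _ hL]
    have hdecomp : g x / (1 + ‖x‖ ^ 2) - g y / (1 + ‖y‖ ^ 2) =
        (g x - g y) * (1 + ‖x‖ ^ 2)⁻¹ + g y * ((1 + ‖x‖ ^ 2)⁻¹ - (1 + ‖y‖ ^ 2)⁻¹) := by
      simp only [div_eq_mul_inv]; ring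
    rw [hdecomp]
    refine (abs_add_le _ _).trans ?_
    have hpos : 0 < 1 + ‖x‖ ^ 2 := by positivity
    have h1 : |(g x - g y) * (1 + ‖x‖ ^ 2)⁻¹| ≤ L₁ * 2 * ‖x - y‖ := by
      rw [abs_mul, abs_of_pos (inv_pos.2 hpos), ← div_eq_mul_inv, div_le_iff₀ hpos]
      calc _ ≤ L₁ * (1 + ‖x‖) * ‖x - y‖ := abs_trigSource_sub_le b h k α x y
        _ ≤ L₁ * (2 * (1 + ‖x‖ ^ 2)) * ‖x - y‖ := by gcongr; exact one_add_norm_le x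
        _ = _ := by ring
    have h2 : |g y * ((1 + ‖x‖ ^ 2)⁻¹ - (1 + ‖y‖ ^ 2)⁻¹)| ≤ L₂ * 4 * ‖x - y‖ := by
      rw [abs_mul]
      calc _ ≤ L₂ * (1 + ‖y‖) * |(1 + ‖x‖ ^ 2)⁻¹ - (1 + ‖y‖ ^ 2)⁻¹| := by
            gcongr; exact abs_trigSource_le b h k α y
        _ = L₂ * (|(1 + ‖x‖ ^ 2)⁻¹ - (1 + ‖y‖ ^ 2)⁻¹| * (1 + ‖y‖)) := by ring
        _ ≤ L₂ * (4 * ‖x - y‖) :=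
            mul_le_mul_of_nonneg_left (abs_inv_one_add_norm_sq_sub_le x y) (by positivity)
        _ = _ := by ring
    linarith
  · refine ⟨(|b| + ‖k‖) * 2, fun x => (abs_trigSource_le b h k α x).trans ?_⟩
    rw [mul_assoc]
    gcongr
    exact one_add_norm_le x

end GeneratorSymbol

namespace FPData

variable {D : FPData H} {hyp : D.Hyp31} {h k : H}

lemma OUData.Rop_trigSource (O : D.OUData hyp) (b : ℝ) (α : ℝ) {t : ℝ} (ht : 0 < t) (x : H) :
    O.Rop t (trigSource b h k α) x = Real.exp (-⟪hyp.Q t h, h⟫_ℝ / 2) *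
      ((b + ⟪hyp.Q t h, k⟫_ℝ) * Real.cos (⟪D.S t x, h⟫_ℝ + α) +
        ⟪D.S t x, k⟫_ℝ * Real.sin (⟪D.S t x, h⟫_ℝ + α)) := by
  have := O.N_prob t ht.le
  have hμ : ∀ h : H, charFun (O.N t) h = Complex.exp (-(⟪hyp.Q t h, h⟫_ℝ : ℂ) / 2) :=
    O.N_char t ht
  set β := ⟪D.S t x, h⟫_ℝ + α with hβ
  obtain ⟨hinteg, hval⟩ := integral_inner_mul_sin_inner_add (hyp.Q_pos t ht) hμ h k β
  have hsplit : (fun y => trigSource b h k α (D.S t x + y)) = fun y =>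
      b * Real.cos (⟪y, h⟫_ℝ + β) + (⟪D.S t x, k⟫_ℝ * Real.sin (⟪y, h⟫_ℝ + β) +
        ⟪y, k⟫_ℝ * Real.sin (⟪y, h⟫_ℝ + β)) := by
    ext y
    have : ⟪D.S t x + y, h⟫_ℝ + α = ⟪y, h⟫_ℝ + β := by rw [inner_add_left, hβ]; ring
    rw [trigSource, this, inner_add_left]
    ring
  have hc := (integrable_cos_inner_add (μ := O.N t) h β).const_mul b
  have hs := (integrable_sin_inner_add (μ := O.N t) h β).const_mul ⟪D.S t x, k⟫_ℝ
  have hsh : Integrable (fun y => ⟪D.S t x, k⟫_ℝ * Real.sin (⟪y, h⟫_ℝ + β) +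
      ⟪y, k⟫_ℝ * Real.sin (⟪y, h⟫_ℝ + β)) (O.N t) := hs.add hinteg
  rw [OUData.Rop, hsplit, integral_add hc hsh, integral_add hs hinteg,
    integral_const_mul, integral_const_mul, hval, integral_cos_inner_add hμ,
    integral_sin_inner_add hμ]
  ring

/-- `R_t cos(⟨·,h⟩ + α)(x)`, discounted by `e^{-λt}`. -/
def discountedTrig (D : FPData H) (lam : ℝ) (h : H) (α : ℝ) (x : H) (t : ℝ) : ℝ :=
  Real.exp (-lam * t) *
    (Real.exp (-D.orbitVariance h t / 2) * Real.cos (⟪D.sg t x, h⟫_ℝ + α))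

/-- The opposite of the time derivative of `discountedTrig`. -/
def discountedTrigDecay (D : FPData H) (lam : ℝ) (h k : H) (α : ℝ) (x : H) (t : ℝ) : ℝ :=
  Real.exp (-lam * t) * (Real.exp (-D.orbitVariance h t / 2) *
    ((lam + D.diffusionForm h t / 2) * Real.cos (⟪D.sg t x, h⟫_ℝ + α) +
      ⟪D.sg t x, k⟫_ℝ * Real.sin (⟪D.sg t x, h⟫_ℝ + α)))

lemma AdjointPair.hasDerivAt_discountedTrig (hk : D.AdjointPair h k) (lam α : ℝ) (x : H)
    {t : ℝ} (ht : 0 < t) :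
    HasDerivAt (D.discountedTrig lam h α x) (-D.discountedTrigDecay lam h k α x t) t := by
  have h1 : HasDerivAt (fun t => Real.exp (-lam * t)) (Real.exp (-lam * t) * -lam) t := by
    simpa using ((hasDerivAt_id t).const_mul (-lam)).exp
  have h2 := ((hk.hasDerivAt_orbitVariance t).neg.div_const 2).exp
  have h3 := ((hk.hasDerivAt_inner_sg x ht).add_const α).cos
  refine (h1.mul (h2.mul h3)).congr_deriv ?_
  simp only [discountedTrigDecay, Pi.neg_apply, Pi.mul_apply]
  ring

lemma AdjointPair.continuous_orbitVariance (hk : D.AdjointPair h k) :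
    Continuous (D.orbitVariance h) :=
  continuous_iff_continuousAt.2 fun t => (hk.hasDerivAt_orbitVariance t).continuousAt

lemma AdjointPair.continuous_discountedTrig (hk : D.AdjointPair h k) (lam α : ℝ) (x : H) :
    Continuous (D.discountedTrig lam h α x) := by
  have h1 := hk.continuous_orbitVariance
  have h2 := continuous_sg_apply (D := D) x
  unfold discountedTrig
  fun_prop

lemma AdjointPair.continuous_discountedTrigDecay (hk : D.AdjointPair h k) (lam α : ℝ) (x : H) :
    Continuous (D.discountedTrigDecay lam h k α x) := by
  have h1 := hk.continuous_orbitVariance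
  have h2 := continuous_sg_apply (D := D) x
  have h3 := hk.continuous_diffusionForm
  unfold discountedTrigDecay
  fun_prop

lemma AdjointPair.integrableOn_discountedTrigDecay (hyp : D.Hyp31) (hk : D.AdjointPair h k)
    {lam : ℝ} (hlam : 0 < lam) (α : ℝ) (x : H) :
    IntegrableOn (D.discountedTrigDecay lam h k α x) (Ioi 0) := by
  obtain ⟨K, hK0, hK⟩ := hk.exists_norm_adjOrbit_sq_le hyp
  obtain ⟨B, hB0, hB⟩ := hk.exists_norm_adjOrbit_snd_sq_le hyp
  set M := lam + ‖D.C‖ * K / 2 + ‖x‖ * (1 + B) with hM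
  refine Integrable.mono' ((exp_neg_integrableOn_Ioi 0 hlam).mul_const (M * 2))
    (hk.continuous_discountedTrigDecay lam α x).aestronglyMeasurable ?_
  filter_upwards [ae_restrict_mem measurableSet_Ioi] with t ht
  have ht0 : 0 ≤ t := le_of_lt ht
  set V := D.orbitVariance h t with hV
  have hV0 : 0 ≤ V := orbitVariance_nonneg ht0
  have hform : D.diffusionForm h t ≤ ‖D.C‖ * K * (1 + V) := by
    calc D.diffusionForm h t ≤ ‖D.C (D.adjOrbit h t)‖ * ‖D.adjOrbit h t‖ :=
          real_inner_le_norm _ _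
      _ ≤ ‖D.C‖ * ‖D.adjOrbit h t‖ * ‖D.adjOrbit h t‖ := by
          gcongr; exact D.C.le_opNorm _
      _ = ‖D.C‖ * ‖D.adjOrbit h t‖ ^ 2 := by ring
      _ ≤ ‖D.C‖ * (K * (1 + V)) := by gcongr; exact hK t ht0
      _ = _ := by ring
  have hdrift : |⟪D.sg t x, k⟫_ℝ| ≤ ‖x‖ * (1 + B) * (1 + V) := by
    rw [inner_sg, mul_assoc]
    refine (abs_real_inner_le_norm _ _).trans ?_
    gcongr
    have := hB t ht0
    nlinarith [sq_nonneg (‖D.adjOrbit k t‖ - 1), norm_nonneg (D.adjOrbit k t)]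
  have hform0 := diffusionForm_nonneg (D := D) (h := h) t
  have hexp : Real.exp (-V / 2) * (1 + V) ≤ 2 := by
    have h1 : 1 + V ≤ 2 * Real.exp (V / 2) := by linarith [Real.add_one_le_exp (V / 2)]
    calc _ ≤ Real.exp (-V / 2) * (2 * Real.exp (V / 2)) := by gcongr
      _ = 2 * Real.exp (-V / 2 + V / 2) := by rw [Real.exp_add]; ring
      _ = 2 := by rw [neg_div, neg_add_cancel, Real.exp_zero, mul_one]
  rw [discountedTrigDecay, norm_mul, norm_mul, Real.norm_of_nonneg (Real.exp_nonneg _),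
    Real.norm_of_nonneg (Real.exp_nonneg _), ← hV]
  refine mul_le_mul_of_nonneg_left ?_ (Real.exp_nonneg _)
  set β := ⟪D.sg t x, h⟫_ℝ + α
  have hsum : ‖(lam + D.diffusionForm h t / 2) * Real.cos β + ⟪D.sg t x, k⟫_ℝ * Real.sin β‖ ≤
      M * (1 + V) := by
    calc _ ≤ |(lam + D.diffusionForm h t / 2)| * |Real.cos β| +
          |⟪D.sg t x, k⟫_ℝ| * |Real.sin β| := by
          rw [← abs_mul, ← abs_mul]; exact abs_add_le _ _
      _ ≤ (lam + D.diffusionForm h t / 2) * 1 + |⟪D.sg t x, k⟫_ℝ| * 1 := by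
          rw [abs_of_nonneg (by positivity : 0 ≤ lam + D.diffusionForm h t / 2)]
          gcongr
          · exact Real.abs_cos_le_one _
          · exact Real.abs_sin_le_one _
      _ ≤ M * (1 + V) := by
          have : 0 ≤ lam * V := by positivity
          rw [hM]
          linarith
  calc _ ≤ Real.exp (-V / 2) * (M * (1 + V)) := by gcongr
    _ = M * (Real.exp (-V / 2) * (1 + V)) := by ring
    _ ≤ M * 2 := by gcongr

lemma tendsto_discountedTrig_atTop {lam : ℝ} (hlam : 0 < lam) (h : H) (α : ℝ) (x : H) :
    Tendsto (D.discountedTrig lam h α x) atTop (𝓝 0) := by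
  have hlim : Tendsto (fun t : ℝ => Real.exp (-lam * t)) atTop (𝓝 0) :=
    Real.tendsto_exp_atBot.comp (tendsto_id.const_mul_atTop_of_neg (neg_neg_of_pos hlam))
  refine squeeze_zero_norm' ?_ hlim
  filter_upwards [eventually_ge_atTop 0] with t ht
  have hV := orbitVariance_nonneg (D := D) (h := h) ht
  rw [discountedTrig, norm_mul, norm_mul, Real.norm_of_nonneg (Real.exp_nonneg _),
    Real.norm_of_nonneg (Real.exp_nonneg _)]
  refine mul_le_of_le_one_right (Real.exp_nonneg _) (mul_le_one₀ ?_ (norm_nonneg _) ?_)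
  · exact Real.exp_le_one_iff.2 (by linarith)
  · exact Real.abs_cos_le_one _

lemma OUData.Gtilde_trigSource (O : D.OUData hyp) (hk : D.AdjointPair h k) {lam : ℝ}
    (hlam : 0 < lam) (α : ℝ) (x : H) :
    O.Gtilde lam (trigSource (lam + ⟪D.C h, h⟫_ℝ / 2) h k α) x = Real.cos (⟪x, h⟫_ℝ + α) := by
  have hG : O.Gtilde lam (trigSource (lam + ⟪D.C h, h⟫_ℝ / 2) h k α) x =
      ∫ t in Ioi (0 : ℝ), D.discountedTrigDecay lam h k α x t := by
    refine setIntegral_congr_fun measurableSet_Ioi fun t ht => ?_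
    have ht' : (0 : ℝ) < t := ht
    simp only [O.Rop_trigSource _ _ ht', discountedTrigDecay, ← sg_of_nonneg ht'.le,
      hk.inner_Q_self hyp ht', hk.diffusionForm_eq hyp ht']
    ring
  have hinteg := hk.integrableOn_discountedTrigDecay hyp hlam α x
  have hFTC := integral_Ioi_of_hasDerivAt_of_tendsto
    (hk.continuous_discountedTrig lam α x).continuousWithinAt
    (fun t ht => hk.hasDerivAt_discountedTrig lam α x ht) hinteg.neg
    (tendsto_discountedTrig_atTop hlam h α x)
  rw [integral_neg, zero_sub, neg_inj] at hFTC
  rw [hG, hFTC]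
  simp [discountedTrig, orbitVariance, sg_zero]

lemma adjointPair_adjoint (hh : h ∈ D.A.adjoint.domain) :
    D.AdjointPair h (D.A.adjoint ⟨h, hh⟩) := fun x => by
  have := LinearPMap.adjoint_isFormalAdjoint D.A_dense ⟨h, hh⟩ x
  rw [real_inner_comm, ← this, real_inner_comm]

end FPData

end OrnsteinUhlenbeckGenerator

section Theorems

open MeasureTheory Set Filter Topology
open scoped InnerProductSpace ENNReal NNReal

variable {H : Type} [NormedAddCommGroup H] [InnerProductSpace ℝ H] [CompleteSpace H]
  [SecondCountableTopology H] [MeasurableSpace H] [BorelSpace H]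

/-- formula (3.1): `cos⟨·,h⟩, sin⟨·,h⟩ ∈ D(U)` for `h ∈ D(A*)`, with
`U(cos⟨·,h⟩) = -(1/2)⟨Ch,h⟩cos⟨·,h⟩ - ⟨·,A*h⟩ sin⟨·,h⟩` and correspondingly for `sin`. -/
theorem statement13 (D : FPData H) (hyp : D.Hyp31) (O : D.OUData hyp)
    (h : H) (hh : h ∈ D.A.adjoint.domain) (lam : ℝ) (hlam : 0 < lam) :
    (∃ g : H → ℝ, MemCu2 g ∧ (∀ x : H, Real.cos ⟪x, h⟫_ℝ = O.Gtilde lam g x) ∧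
      ∀ x : H, lam * Real.cos ⟪x, h⟫_ℝ - g x =
        -(1 / 2) * ⟪D.C h, h⟫_ℝ * Real.cos ⟪x, h⟫_ℝ -
          ⟪x, D.A.adjoint ⟨h, hh⟩⟫_ℝ * Real.sin ⟪x, h⟫_ℝ) ∧
    (∃ g : H → ℝ, MemCu2 g ∧ (∀ x : H, Real.sin ⟪x, h⟫_ℝ = O.Gtilde lam g x) ∧
      ∀ x : H, lam * Real.sin ⟪x, h⟫_ℝ - g x =
        -(1 / 2) * ⟪D.C h, h⟫_ℝ * Real.sin ⟪x, h⟫_ℝ +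
          ⟪x, D.A.adjoint ⟨h, hh⟩⟫_ℝ * Real.cos ⟪x, h⟫_ℝ) := by
  set k := D.A.adjoint ⟨h, hh⟩
  have hpair : D.AdjointPair h k := FPData.adjointPair_adjoint hh
  set b := lam + ⟪D.C h, h⟫_ℝ / 2 with hb
  refine ⟨⟨trigSource b h k 0, memCu2_trigSource b h k 0, fun x => ?_, fun x => ?_⟩,
    ⟨trigSource b h k (-(Real.pi / 2)), memCu2_trigSource b h k _, fun x => ?_, fun x => ?_⟩⟩
  · rw [O.Gtilde_trigSource hpair hlam, add_zero]
  · rw [trigSource, add_zero, hb]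
    ring
  · rw [O.Gtilde_trigSource hpair hlam, ← sub_eq_add_neg, Real.cos_sub_pi_div_two]
  · rw [trigSource, ← sub_eq_add_neg, Real.cos_sub_pi_div_two, Real.sin_sub_pi_div_two, hb]
    ring

end Theorems
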